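/- arXiv:2602.15193 — 2 statements merged into one kernel-verified Lean document; each statement's English description precedes it below -/
import Mathlib

section
/- Let n ∈ ℕ and c ∈ ℝ³. The space (𝒫ⁿ)³ of vector-valued polynomial maps ℝ³ → ℝ³ of total degree at most n is the internal direct sum of the subspaces 𝒞ⁿ := {curl v : v ∈ (𝒫^{n+1})³} and 𝒞ⁿ_c := {x ↦ p(x)(x − c) : p ∈ 𝒫^{n−1}}, i.e., every τ ∈ (𝒫ⁿ)³ decomposes uniquely as τ = curl v + p·(x − c) with v ∈ (𝒫^{n+1})³ and p ∈ 𝒫^{n−1}. -/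
open Matrix MeasureTheory
open scoped InnerProductSpace

noncomputable section

/-- Scalar polynomial functions `ℝ^d → ℝ` of total degree at most `n`. -/
def polySpace (d n : ℕ) : Submodule ℝ ((Fin d → ℝ) → ℝ) where
  carrier := {f | ∃ p : MvPolynomial (Fin d) ℝ,
    p.totalDegree ≤ n ∧ ∀ x, f x = MvPolynomial.eval x p}
  add_mem' := by
    rintro f g ⟨p, hp, hfp⟩ ⟨q, hq, hgq⟩
    exact ⟨p + q, le_trans (MvPolynomial.totalDegree_add p q) (max_le hp hq),
      fun x => by simp [hfp x, hgq x]⟩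
  zero_mem' := ⟨0, by simp, fun x => by simp⟩
  smul_mem' := by
    rintro a f ⟨p, hp, hfp⟩
    exact ⟨a • p, le_trans (MvPolynomial.totalDegree_smul_le a p) hp,
      fun x => by simp [hfp x, MvPolynomial.smul_eval]⟩

/-- Scalar polynomial functions of total degree at most `n` for `n : ℤ`,
with the convention that the space is `{0}` for negative `n`. -/
def polySpaceZ (d : ℕ) (n : ℤ) : Submodule ℝ ((Fin d → ℝ) → ℝ) :=
  if 0 ≤ n then polySpace d n.toNat else ⊥

/-- Vector-valued polynomial maps `ℝ^d → ℝ^d`, all of whose components are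
polynomial functions of total degree at most `n` (`n : ℤ`). -/
def vecPolySpaceZ (d : ℕ) (n : ℤ) : Submodule ℝ ((Fin d → ℝ) → (Fin d → ℝ)) where
  carrier := {f | ∀ i, (fun x => f x i) ∈ polySpaceZ d n}
  add_mem' := fun hf hg i => (polySpaceZ d n).add_mem (hf i) (hg i)
  zero_mem' := fun i => (polySpaceZ d n).zero_mem
  smul_mem' := fun a {f} hf i => (polySpaceZ d n).smul_mem a (hf i)

/-- The gradient `∇v = (∂₁v, …, ∂_d v)` of a scalar field. -/
def grad {d : ℕ} (v : (Fin d → ℝ) → ℝ) : (Fin d → ℝ) → (Fin d → ℝ) :=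
  fun x i => fderiv ℝ v x (Pi.single i 1)

/-- The divergence `div τ = Σᵢ ∂ᵢ τᵢ` of a vector field. -/
def divg {d : ℕ} (τ : (Fin d → ℝ) → (Fin d → ℝ)) : (Fin d → ℝ) → ℝ :=
  fun x => ∑ i, fderiv ℝ (fun y => τ y i) x (Pi.single i 1)

/-- The curl of a vector field on `ℝ³`. -/
def curl (v : (Fin 3 → ℝ) → (Fin 3 → ℝ)) : (Fin 3 → ℝ) → (Fin 3 → ℝ) :=
  fun x => ![fderiv ℝ (fun y => v y 2) x (Pi.single 1 1) - fderiv ℝ (fun y => v y 1) x (Pi.single 2 1),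
             fderiv ℝ (fun y => v y 0) x (Pi.single 2 1) - fderiv ℝ (fun y => v y 2) x (Pi.single 0 1),
             fderiv ℝ (fun y => v y 1) x (Pi.single 0 1) - fderiv ℝ (fun y => v y 0) x (Pi.single 1 1)]

/-- Rotation of a vector in `ℝ²` by `-π/2`: `(z₁, z₂)^⊥ = (z₂, -z₁)`. -/
def perp (z : Fin 2 → ℝ) : Fin 2 → ℝ := ![z 1, -z 0]

open MvPolynomial in
theorem aux_hasFDerivAt (p : MvPolynomial (Fin 3) ℝ) (x : Fin 3 → ℝ) :
    HasFDerivAt (fun y => eval y p)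
      (∑ i, (eval x (pderiv i p)) • (ContinuousLinearMap.proj i : (Fin 3 → ℝ) →L[ℝ] ℝ)) x := by
  induction p using MvPolynomial.induction_on with
  | C a => simpa using hasFDerivAt_const a x
  | add p q hp hq =>
    have := hp.add hq
    simp only [map_add, add_smul, Finset.sum_add_distrib]
    exact this
  | mul_X p j hp =>
    have h2 : HasFDerivAt (fun y : Fin 3 → ℝ => y j)
      (ContinuousLinearMap.proj j : (Fin 3 → ℝ) →L[ℝ] ℝ) x :=
      (ContinuousLinearMap.proj j : (Fin 3 → ℝ) →L[ℝ] ℝ).hasFDerivAt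
    have := hp.mul h2
    simp only [map_mul, eval_X]
    refine this.congr_fderiv ?_
    ext v
    fin_cases j <;> simp [Fin.sum_univ_three, pderiv_mul, pderiv_X, Pi.single_apply] <;> ring

open MvPolynomial in
theorem aux_fderiv (p : MvPolynomial (Fin 3) ℝ) (x : Fin 3 → ℝ) (i : Fin 3) :
    fderiv ℝ (fun y => eval y p) x (Pi.single i 1) = eval x (pderiv i p) := by
  rw [(aux_hasFDerivAt p x).fderiv]
  simp [Pi.single_apply]

open MvPolynomial in
theorem aux_deg (p : MvPolynomial (Fin 3) ℝ) (i : Fin 3) (n : ℕ) (hp : p.totalDegree ≤ n) :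
    pderiv i p = 0 ∨ (pderiv i p).totalDegree + 1 ≤ n := by
  by_cases h : pderiv i p = 0
  · exact Or.inl h
  right
  have key : ∀ m, coeff m (pderiv i p) ≠ 0 → (m.sum fun _ e => e) + 1 ≤ n := by
    intro m hm
    rw [coeff_pderiv] at hm
    have h1 : coeff (m + Finsupp.single i 1) p ≠ 0 := by
      intro h0; simp [h0] at hm
    have h2 := le_totalDegree (mem_support_iff.2 h1)
    rw [Finsupp.sum_add_index' (by simp) (by simp)] at h2
    simp at h2
    omega
  obtain ⟨m, hm⟩ := MvPolynomial.ne_zero_iff.1 h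
  have h1 := key m hm
  have : (pderiv i p).totalDegree ≤ n - 1 := by
    refine Finset.sup_le fun m hm => ?_
    have := key m (mem_support_iff.1 hm)
    omega
  omega

open MvPolynomial in
theorem aux_comm (i j : Fin 3) (p : MvPolynomial (Fin 3) ℝ) :
    pderiv i (pderiv j p) = pderiv j (pderiv i p) := by
  have : ⁅(pderiv i : Derivation ℝ (MvPolynomial (Fin 3) ℝ) (MvPolynomial (Fin 3) ℝ)),
      (pderiv j : Derivation ℝ (MvPolynomial (Fin 3) ℝ) (MvPolynomial (Fin 3) ℝ))⁆ = 0 := by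
    apply MvPolynomial.derivation_ext
    intro k
    fin_cases k <;> fin_cases i <;> fin_cases j <;> simp [Derivation.commutator_apply, pderiv_X]
  have h := congrArg (fun D => D p) this
  simpa [Derivation.commutator_apply, sub_eq_zero] using h

open MvPolynomial in
/-- Euler-type operator `E + k` about `c`. -/
def eulerOp (c : Fin 3 → ℝ) (k : ℕ) : MvPolynomial (Fin 3) ℝ →ₗ[ℝ] MvPolynomial (Fin 3) ℝ :=
  (∑ i, LinearMap.mulLeft ℝ (X i - C (c i)) ∘ₗ (pderiv i).toLinearMap) + (k : ℝ) • LinearMap.id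

open MvPolynomial in
theorem eulerOp_apply (c : Fin 3 → ℝ) (k : ℕ) (p : MvPolynomial (Fin 3) ℝ) :
    eulerOp c k p = (X 0 - C (c 0)) * pderiv 0 p + (X 1 - C (c 1)) * pderiv 1 p
      + (X 2 - C (c 2)) * pderiv 2 p + (k : MvPolynomial (Fin 3) ℝ) * p := by
  simp [eulerOp, Fin.sum_univ_three, smul_eq_C_mul]

open MvPolynomial in
theorem eulerOp_inj (c : Fin 3 → ℝ) (k : ℕ) (p : MvPolynomial (Fin 3) ℝ)
    (h : eulerOp c (k + 1) p = 0) : p = 0 := by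
  apply MvPolynomial.funext
  intro z
  rw [map_zero]
  have hl : ∀ t : ℝ, HasDerivAt (fun t : ℝ => c + t • (z - c)) (z - c) t := by
    intro t
    simpa using ((hasDerivAt_id t).smul_const (z - c)).const_add c
  have hd : ∀ t : ℝ, HasDerivAt (fun t : ℝ => t ^ (k + 1) * eval (c + t • (z - c)) p) 0 t := by
    intro t
    have h1 := (aux_hasFDerivAt p (c + t • (z - c))).comp_hasDerivAt t (hl t)
    have h2 := (hasDerivAt_pow (k + 1) t).mul h1
    refine h2.congr_deriv ?_
    have h3 := congrArg (eval (c + t • (z - c))) h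
    rw [eulerOp_apply] at h3
    simp at h3
    simp [Fin.sum_univ_three]
    linear_combination t ^ k * h3
  have hc := is_const_of_deriv_eq_zero (fun t => (hd t).differentiableAt)
    (fun t => (hd t).deriv) 1 0
  simpa using hc

open MvPolynomial in
theorem aux_mul_deg (c : Fin 3 → ℝ) (i : Fin 3) (n : ℕ) (q : MvPolynomial (Fin 3) ℝ)
    (h : q = 0 ∨ q.totalDegree + 1 ≤ n) : (q * (X i - C (c i))).totalDegree ≤ n := by
  rcases h with rfl | h
  · simp
  · refine (totalDegree_mul _ _).trans ?_
    have := totalDegree_sub_C_le (X i : MvPolynomial (Fin 3) ℝ) (c i)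
    rw [totalDegree_X] at this
    omega

open MvPolynomial in
theorem eulerOp_deg (c : Fin 3 → ℝ) (k n : ℕ) (p : MvPolynomial (Fin 3) ℝ)
    (hp : p ∈ restrictTotalDegree (Fin 3) ℝ n) :
    eulerOp c k p ∈ restrictTotalDegree (Fin 3) ℝ n := by
  have hd := (mem_restrictTotalDegree _ _ _).1 hp
  unfold eulerOp
  rw [LinearMap.add_apply, LinearMap.sum_apply]
  refine Submodule.add_mem _ (Submodule.sum_mem _ fun i _ => ?_) (Submodule.smul_mem _ _ hp)
  rw [mem_restrictTotalDegree]
  simpa [mul_comm] using aux_mul_deg c i n _ (aux_deg p i n hd)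

open MvPolynomial in
theorem eulerOp_surj (c : Fin 3 → ℝ) (k n : ℕ) (p : MvPolynomial (Fin 3) ℝ)
    (hp : p.totalDegree ≤ n) :
    ∃ q : MvPolynomial (Fin 3) ℝ, q.totalDegree ≤ n ∧ eulerOp c (k + 1) q = p := by
  let T := (eulerOp c (k + 1)).restrict (eulerOp_deg c (k + 1) n)
  have hT : Function.Injective T := by
    rw [injective_iff_map_eq_zero]
    intro a ha
    exact Subtype.ext (eulerOp_inj c k a (congrArg Subtype.val ha))
  obtain ⟨q, hq⟩ := LinearMap.surjective_of_injective hT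
    ⟨p, (mem_restrictTotalDegree _ _ _).2 hp⟩
  exact ⟨q, (mem_restrictTotalDegree _ _ _).1 q.2, congrArg Subtype.val hq⟩

open MvPolynomial in
theorem mem_nat (n : ℕ) (f : (Fin 3 → ℝ) → ℝ) : f ∈ polySpaceZ 3 (n : ℤ) ↔
    ∃ p : MvPolynomial (Fin 3) ℝ, p.totalDegree ≤ n ∧ f = fun x => eval x p := by
  simp only [polySpaceZ, Int.natCast_nonneg, if_true, Int.toNat_natCast, funext_iff]
  rfl

open MvPolynomial in
theorem mem_pred (n : ℕ) (f : (Fin 3 → ℝ) → ℝ) : f ∈ polySpaceZ 3 ((n : ℤ) - 1) ↔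
    ∃ p : MvPolynomial (Fin 3) ℝ, (p = 0 ∨ p.totalDegree + 1 ≤ n) ∧ f = fun x => eval x p := by
  rcases n with _ | n
  · simp [polySpaceZ]
    rfl
  · have : ((n + 1 : ℕ) : ℤ) - 1 = (n : ℤ) := by push_cast; ring
    rw [this, mem_nat]
    constructor
    · rintro ⟨p, h, rfl⟩
      exact ⟨p, Or.inr (by omega), rfl⟩
    · rintro ⟨p, h, rfl⟩
      refine ⟨p, ?_, rfl⟩
      rcases h with rfl | h
      · simp
      · omega

open MvPolynomial in
theorem mem_vec (n : ℕ) (f : (Fin 3 → ℝ) → (Fin 3 → ℝ)) : f ∈ vecPolySpaceZ 3 (n : ℤ) ↔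
    ∃ p : Fin 3 → MvPolynomial (Fin 3) ℝ, (∀ i, (p i).totalDegree ≤ n) ∧
      f = fun x i => eval x (p i) := by
  constructor
  · intro h
    choose p hp hf using fun i => (mem_nat n _).1 (h i)
    exact ⟨p, hp, by ext x i; exact congrFun (hf i) x⟩
  · rintro ⟨p, hp, rfl⟩ i
    exact (mem_nat n _).2 ⟨p i, hp i, rfl⟩

open MvPolynomial in
/-- Curl of a polynomial field. -/
def pcurl (v : Fin 3 → MvPolynomial (Fin 3) ℝ) : Fin 3 → MvPolynomial (Fin 3) ℝ :=
  ![pderiv 1 (v 2) - pderiv 2 (v 1), pderiv 2 (v 0) - pderiv 0 (v 2),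
    pderiv 0 (v 1) - pderiv 1 (v 0)]

open MvPolynomial in
theorem curl_eval (v : Fin 3 → MvPolynomial (Fin 3) ℝ) :
    curl (fun x i => eval x (v i)) = fun x i => eval x (pcurl v i) := by
  ext x i
  fin_cases i <;> simp [curl, pcurl, aux_fderiv]

open MvPolynomial in
theorem pcurl_deg (n : ℕ) (v : Fin 3 → MvPolynomial (Fin 3) ℝ)
    (h : ∀ i, (v i).totalDegree ≤ n + 1) (i : Fin 3) : (pcurl v i).totalDegree ≤ n := by
  have key : ∀ i j, (pderiv i (v j)).totalDegree ≤ n := by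
    intro i j
    rcases aux_deg (v j) i _ (h j) with h | h
    · simp [h]
    · omega
  fin_cases i <;> exact (totalDegree_sub _ _).trans (max_le (key _ _) (key _ _))

open MvPolynomial in
theorem pcurl_div (v : Fin 3 → MvPolynomial (Fin 3) ℝ) :
    pderiv 0 (pcurl v 0) + pderiv 1 (pcurl v 1) + pderiv 2 (pcurl v 2) = 0 := by
  simp only [pcurl, Matrix.cons_val, map_sub]
  rw [aux_comm 1 0, aux_comm 2 0, aux_comm 2 1]
  ring

open MvPolynomial in
/-- The polynomial field `u × (x - c)`. -/
def pcross (c : Fin 3 → ℝ) (u : Fin 3 → MvPolynomial (Fin 3) ℝ) :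
    Fin 3 → MvPolynomial (Fin 3) ℝ :=
  ![u 1 * (X 2 - C (c 2)) - u 2 * (X 1 - C (c 1)),
    u 2 * (X 0 - C (c 0)) - u 0 * (X 2 - C (c 2)),
    u 0 * (X 1 - C (c 1)) - u 1 * (X 0 - C (c 0))]

open MvPolynomial in
theorem pcurl_pcross (c : Fin 3 → ℝ) (u : Fin 3 → MvPolynomial (Fin 3) ℝ) (i : Fin 3) :
    pcurl (pcross c u) i + (pderiv 0 (u 0) + pderiv 1 (u 1) + pderiv 2 (u 2)) * (X i - C (c i))
      = eulerOp c 2 (u i) := by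
  rw [eulerOp_apply]
  fin_cases i <;>
    simp [pcurl, pcross, pderiv_mul, pderiv_X, Pi.single_apply] <;> ring

open MvPolynomial in
theorem aux_unique (c : Fin 3 → ℝ) (v w : Fin 3 → MvPolynomial (Fin 3) ℝ)
    (p q : MvPolynomial (Fin 3) ℝ)
    (h : ∀ i, pcurl v i + p * (X i - C (c i)) = pcurl w i + q * (X i - C (c i))) : p = q := by
  rw [← sub_eq_zero]
  apply eulerOp_inj c 2
  rw [eulerOp_apply]
  have h0 := congrArg (pderiv 0) (h 0)
  have h1 := congrArg (pderiv 1) (h 1)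
  have h2 := congrArg (pderiv 2) (h 2)
  simp only [map_add, map_sub, pderiv_mul, pderiv_X_self, pderiv_C] at h0 h1 h2
  simp only [map_sub]
  push_cast
  linear_combination h0 + h1 + h2 - pcurl_div v + pcurl_div w

/-- `(𝒫ⁿ)³ = 𝒞ⁿ ⊕ 𝒞ⁿ_c` in `ℝ³`: every vector polynomial `τ` of total
degree at most `n` decomposes uniquely as `τ = curl v + (x ↦ p x • (x - c))` with
`v ∈ (𝒫^{n+1})³` and `p ∈ 𝒫^{n-1}`. -/
theorem statement1 (n : ℕ) (c : Fin 3 → ℝ) :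
    let C : Set ((Fin 3 → ℝ) → (Fin 3 → ℝ)) :=
      {f | ∃ v ∈ vecPolySpaceZ 3 ((n : ℤ) + 1), f = curl v}
    let Cc : Set ((Fin 3 → ℝ) → (Fin 3 → ℝ)) :=
      {f | ∃ p ∈ polySpaceZ 3 ((n : ℤ) - 1), f = fun x => p x • (x - c)}
    C ⊆ (vecPolySpaceZ 3 (n : ℤ) : Set _) ∧
    Cc ⊆ (vecPolySpaceZ 3 (n : ℤ) : Set _) ∧
    ∀ τ ∈ vecPolySpaceZ 3 (n : ℤ), ∃ g ∈ C, ∃ h ∈ Cc,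
      τ = g + h ∧ ∀ g' ∈ C, ∀ h' ∈ Cc, τ = g' + h' → g' = g ∧ h' = h := by
  intro C Cc
  have hC : ∀ f, f ∈ C ↔ ∃ v : Fin 3 → MvPolynomial (Fin 3) ℝ,
      (∀ i, (v i).totalDegree ≤ n + 1) ∧ f = fun x i => MvPolynomial.eval x (pcurl v i) := by
    intro f
    constructor
    · rintro ⟨v, hv, rfl⟩
      obtain ⟨p, hp, rfl⟩ := (mem_vec (n + 1) v).1 (by exact_mod_cast hv)
      exact ⟨p, hp, curl_eval p⟩
    · rintro ⟨p, hp, rfl⟩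
      exact ⟨_, by exact_mod_cast (mem_vec (n + 1) _).2 ⟨p, hp, rfl⟩, (curl_eval p).symm⟩
  have hCc : ∀ f, f ∈ Cc ↔ ∃ p : MvPolynomial (Fin 3) ℝ,
      (p = 0 ∨ p.totalDegree + 1 ≤ n) ∧
      f = fun x i => MvPolynomial.eval x (p * (MvPolynomial.X i - MvPolynomial.C (c i))) := by
    intro f
    constructor
    · rintro ⟨v, hv, rfl⟩
      obtain ⟨p, hp, rfl⟩ := (mem_pred n v).1 hv
      exact ⟨p, hp, by ext x i; simp⟩
    · rintro ⟨p, hp, rfl⟩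
      exact ⟨_, (mem_pred n _).2 ⟨p, hp, rfl⟩, by ext x i; simp⟩
  refine ⟨?_, ?_, ?_⟩
  · intro f hf
    obtain ⟨v, hv, rfl⟩ := (hC f).1 hf
    exact (mem_vec n _).2 ⟨_, pcurl_deg n v hv, rfl⟩
  · intro f hf
    obtain ⟨p, hp, rfl⟩ := (hCc f).1 hf
    exact (mem_vec n _).2 ⟨_, fun i => aux_mul_deg c i n p hp, rfl⟩
  · intro τ hτ
    obtain ⟨t, ht, rfl⟩ := (mem_vec n τ).1 hτ
    choose u hu hut using fun i => eulerOp_surj c 1 n (t i) (ht i)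
    have hdiv : (fun x => MvPolynomial.eval x (MvPolynomial.pderiv 0 (u 0)
        + MvPolynomial.pderiv 1 (u 1) + MvPolynomial.pderiv 2 (u 2)))
        ∈ polySpaceZ 3 ((n : ℤ) - 1) := by
      have key : ∀ i, (fun x => MvPolynomial.eval x (MvPolynomial.pderiv i (u i)))
          ∈ polySpaceZ 3 ((n : ℤ) - 1) := fun i =>
        (mem_pred n _).2 ⟨_, aux_deg _ i n (hu i), rfl⟩
      simp only [map_add]
      exact Submodule.add_mem _ (Submodule.add_mem _ (key 0) (key 1)) (key 2)
    obtain ⟨D, hD, hDe⟩ := (mem_pred n _).1 hdiv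
    have hDD := MvPolynomial.funext (fun x => congrFun hDe x)
    have hw : ∀ i, (pcross c u i).totalDegree ≤ n + 1 := by
      have key : ∀ i j, (u i * (MvPolynomial.X j - MvPolynomial.C (c j))).totalDegree ≤ n + 1 :=
        fun i j => aux_mul_deg c j _ _ (Or.inr (by have := hu i; omega))
      intro i
      fin_cases i <;>
        exact (MvPolynomial.totalDegree_sub _ _).trans (max_le (key _ _) (key _ _))
    have hdec : ∀ i, pcurl (pcross c u) i + D * (MvPolynomial.X i - MvPolynomial.C (c i)) = t i := by
      intro i
      rw [← hDD, pcurl_pcross, hut]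
    refine ⟨_, (hC _).2 ⟨_, hw, rfl⟩, _, (hCc _).2 ⟨D, hD, rfl⟩, ?_, ?_⟩
    · ext x i
      rw [← hdec i]
      simp
    · intro g' hg' h' hh' he
      obtain ⟨v, hv, rfl⟩ := (hC _).1 hg'
      obtain ⟨p, hp, rfl⟩ := (hCc _).1 hh'
      have hv' : ∀ i, t i = pcurl v i + p * (MvPolynomial.X i - MvPolynomial.C (c i)) := by
        intro i
        apply MvPolynomial.funext
        intro x
        have := congrFun (congrFun he x) i
        simpa using this
      have hpD : p = D := aux_unique c v (pcross c u) p D fun i => by rw [hdec, hv']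
      subst hpD
      refine ⟨?_, rfl⟩
      ext x i
      have := (hdec i).trans (hv' i)
      rw [add_right_cancel this]

end
end

section
/- Let n ∈ ℕ, n ≥ 1, and c ∈ ℝ³, and define the Nédélec space 𝒩ⁿ_c := 𝒢^{n−1} + 𝒢ⁿ_c, where 𝒢^{n−1} := {∇p : p ∈ 𝒫ⁿ} and 𝒢ⁿ_c := {x ↦ q(x) × (x − c) : q ∈ (𝒫^{n−1})³}. Then: (i) the sum 𝒢^{n−1} + 𝒢ⁿ_c is direct; (ii) 𝒩ⁿ_c = (𝒫^{n−1})³ + {x ↦ q(x) × (x − c) : q ∈ (𝒫^{n−1})³}; (iii) the inclusions (𝒫^{n−1})³ ⊂ 𝒩ⁿ_c ⊂ (𝒫ⁿ)³ hold and are both strict. -/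
open Matrix MeasureTheory
open scoped InnerProductSpace

noncomputable section

open MvPolynomial in
lemma aux_pderiv_deg (P : MvPolynomial (Fin 3) ℝ) (n : ℕ) (h : P.totalDegree ≤ n) (i : Fin 3) :
    (pderiv i P).totalDegree ≤ n - 1 := by
  rw [← sum_homogeneousComponent P, map_sum]
  apply totalDegree_finsetSum_le
  intro k hk
  have := ((homogeneousComponent_isHomogeneous k P).pderiv (i := i)).totalDegree_le
  have := Finset.mem_range.1 hk
  omega

open MvPolynomial in
lemma aux_hasFDeriv (P : MvPolynomial (Fin 3) ℝ) (x : Fin 3 → ℝ) :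
    HasFDerivAt (fun x => eval x P)
      (∑ i, eval x (pderiv i P) • (ContinuousLinearMap.proj i : (Fin 3 → ℝ) →L[ℝ] ℝ)) x := by
  induction P using MvPolynomial.induction_on with
  | C a => simpa using hasFDerivAt_const (𝕜 := ℝ) a x
  | add p q hp hq =>
    simp only [map_add, add_smul, Finset.sum_add_distrib]
    exact hp.add hq
  | mul_X p j hp =>
    have hj : HasFDerivAt (fun x : Fin 3 → ℝ => x j)
      (ContinuousLinearMap.proj j : (Fin 3 → ℝ) →L[ℝ] ℝ) x := hasFDerivAt_apply j x
    have := hp.mul hj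
    simp only [map_mul, eval_X]
    refine this.congr_fderiv ?_
    ext v
    fin_cases j <;> simp [Fin.sum_univ_three, pderiv_X, Pi.single_apply] <;> ring

open MvPolynomial in
lemma aux_grad (P : MvPolynomial (Fin 3) ℝ) (f : (Fin 3 → ℝ) → ℝ) (c : Fin 3 → ℝ)
    (h : ∀ x, f x = eval (x - c) P) (x : Fin 3 → ℝ) (i : Fin 3) :
    grad f x i = eval (x - c) (pderiv i P) := by
  have h1 : f = fun x => eval (x - c) P := funext h
  have h2 := (aux_hasFDeriv P (x - c)).comp x ((hasFDerivAt_id x).sub_const c)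
  have h3 : HasFDerivAt f ((∑ i, eval (x - c) (pderiv i P) • (ContinuousLinearMap.proj i : (Fin 3 → ℝ) →L[ℝ] ℝ)).comp (ContinuousLinearMap.id ℝ (Fin 3 → ℝ))) x := by rw [h1]; exact h2
  unfold grad
  rw [h3.fderiv]
  fin_cases i <;> simp [Fin.sum_univ_three]

open MvPolynomial in
lemma aux_trans (P : MvPolynomial (Fin 3) ℝ) (n : ℕ) (h : P.totalDegree ≤ n) (c : Fin 3 → ℝ) :
    ∃ Q : MvPolynomial (Fin 3) ℝ, Q.totalDegree ≤ n ∧ ∀ x, eval x Q = eval (x + c) P := by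
  refine ⟨aeval (fun i => X i + C (c i)) P, ?_, ?_⟩
  · rw [aeval_def, eval₂_eq']
    apply totalDegree_finsetSum_le
    intro d hd
    refine (totalDegree_mul _ _).trans ?_
    have h1 : (algebraMap ℝ (MvPolynomial (Fin 3) ℝ) (coeff d P)).totalDegree = 0 := totalDegree_C _
    rw [h1, zero_add]
    refine (totalDegree_finsetProd _ _).trans ?_
    refine le_trans ?_ ((le_totalDegree hd).trans h)
    rw [Finsupp.sum_fintype _ _ (by simp)]
    apply Finset.sum_le_sum
    intro i _
    refine (totalDegree_pow _ _).trans ?_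
    have : (X i + C (c i) : MvPolynomial (Fin 3) ℝ).totalDegree ≤ 1 :=
      (totalDegree_add _ _).trans (by simp)
    nlinarith
  · intro x
    rw [← coe_aeval_eq_eval, ← coe_aeval_eq_eval]
    change (aeval x).comp (aeval _) P = _
    rw [comp_aeval]
    simp
    rfl

open MvPolynomial in
lemma aux_hom (k : ℕ) (P : Fin 3 → MvPolynomial (Fin 3) ℝ) (h : ∀ i, (P i).IsHomogeneous k) :
    ∃ (p : MvPolynomial (Fin 3) ℝ) (q : Fin 3 → MvPolynomial (Fin 3) ℝ),
      p.totalDegree ≤ k + 1 ∧ (∀ i, (q i).totalDegree ≤ k) ∧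
      ∀ i, P i = pderiv i p + crossProduct q X i := by
  have ha : ∃ a : ℝ, a * (k + 1) = 1 := ⟨((k : ℝ) + 1)⁻¹, inv_mul_cancel₀ (by positivity)⟩
  obtain ⟨a, ha⟩ := ha
  have hC : (C a : MvPolynomial (Fin 3) ℝ) * (k + 1) = 1 := by
    have := congrArg (C : ℝ → MvPolynomial (Fin 3) ℝ) ha
    simpa only [map_mul, map_add, map_natCast, map_one] using this
  have hd : ∀ i j, (pderiv i (P j)).totalDegree ≤ k := fun i j =>
    (h j).pderiv.totalDegree_le.trans (Nat.sub_le _ _)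
  have hs : ∀ i j k' l, (a • (pderiv i (P j) - pderiv k' (P l))).totalDegree ≤ k := fun i j k' l =>
    (totalDegree_smul_le _ _).trans ((totalDegree_sub _ _).trans (max_le (hd _ _) (hd _ _)))
  refine ⟨a • ∑ i, X i * P i, a • ![pderiv 1 (P 2) - pderiv 2 (P 1),
    pderiv 2 (P 0) - pderiv 0 (P 2), pderiv 0 (P 1) - pderiv 1 (P 0)], ?_, ?_, ?_⟩
  · refine (totalDegree_smul_le _ _).trans (totalDegree_finsetSum_le fun i _ => ?_)
    refine (totalDegree_mul _ _).trans ?_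
    have := (h i).totalDegree_le
    rw [totalDegree_X]; omega
  · intro i
    fin_cases i <;> exact hs _ _ _ _
  · intro i
    have e := (h i).sum_X_mul_pderiv
    rw [Fin.sum_univ_three] at e
    simp only [nsmul_eq_mul] at e
    fin_cases i <;>
    · simp [cross_apply, Fin.sum_univ_three, pderiv_X, Pi.single_apply, smul_eq_C_mul] at e ⊢
      linear_combination (-C a) * e - P _ * hC

open MvPolynomial in
lemma aux_poinc (m : ℕ) (P : Fin 3 → MvPolynomial (Fin 3) ℝ) (h : ∀ i, (P i).totalDegree ≤ m) :
    ∃ (p : MvPolynomial (Fin 3) ℝ) (q : Fin 3 → MvPolynomial (Fin 3) ℝ),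
      p.totalDegree ≤ m + 1 ∧ (∀ i, (q i).totalDegree ≤ m) ∧
      ∀ i, P i = pderiv i p + crossProduct q X i := by
  have H := fun k => aux_hom k (fun i => homogeneousComponent k (P i))
    (fun i => homogeneousComponent_isHomogeneous k (P i))
  choose p q hp hq e using H
  refine ⟨∑ k ∈ Finset.range (m + 1), p k, ∑ k ∈ Finset.range (m + 1), q k, ?_, ?_, ?_⟩
  · apply totalDegree_finsetSum_le
    intro k hk
    have := Finset.mem_range.1 hk
    have := hp k
    omega
  · intro i
    rw [Finset.sum_apply]
    apply totalDegree_finsetSum_le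
    intro k hk
    have := Finset.mem_range.1 hk
    have := hq k i
    omega
  · intro i
    have : P i = ∑ k ∈ Finset.range (m + 1), homogeneousComponent k (P i) := by
      conv_lhs => rw [← sum_homogeneousComponent (P i)]
      apply Finset.sum_subset
      · intro k hk
        have := h i
        simp at hk ⊢; omega
      · intro k _ hk
        apply homogeneousComponent_eq_zero
        simp at hk; omega
    rw [this]
    simp only [e, map_sum, LinearMap.sum_apply, Finset.sum_apply, Finset.sum_add_distrib]

lemma aux_mem (n : ℕ) (f : (Fin 3 → ℝ) → ℝ) : f ∈ polySpaceZ 3 (n : ℤ) ↔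
    ∃ p : MvPolynomial (Fin 3) ℝ, p.totalDegree ≤ n ∧ ∀ x, f x = MvPolynomial.eval x p := by
  unfold polySpaceZ
  rw [if_pos (by positivity), Int.toNat_natCast]
  rfl

open MvPolynomial in
lemma aux_mem' (n : ℕ) (c : Fin 3 → ℝ) (f : (Fin 3 → ℝ) → ℝ) : f ∈ polySpaceZ 3 (n : ℤ) ↔
    ∃ p : MvPolynomial (Fin 3) ℝ, p.totalDegree ≤ n ∧ ∀ x, f x = MvPolynomial.eval (x - c) p := by
  rw [aux_mem]
  constructor
  · rintro ⟨p, hp, e⟩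
    obtain ⟨q, hq, e'⟩ := aux_trans p n hp c
    exact ⟨q, hq, fun x => by rw [e, e']; simp⟩
  · rintro ⟨p, hp, e⟩
    obtain ⟨q, hq, e'⟩ := aux_trans p n hp (-c)
    exact ⟨q, hq, fun x => by rw [e, e', sub_eq_add_neg]⟩

lemma aux_vmem (n : ℕ) (c : Fin 3 → ℝ) (f : (Fin 3 → ℝ) → (Fin 3 → ℝ)) :
    f ∈ vecPolySpaceZ 3 (n : ℤ) ↔
    ∃ p : Fin 3 → MvPolynomial (Fin 3) ℝ, (∀ i, (p i).totalDegree ≤ n) ∧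
      ∀ x i, f x i = MvPolynomial.eval (x - c) (p i) := by
  change (∀ i, (fun x => f x i) ∈ polySpaceZ 3 (n : ℤ)) ↔ _
  simp only [aux_mem' n c]
  constructor
  · intro h
    choose p hp e using h
    exact ⟨p, hp, fun x i => e i x⟩
  · rintro ⟨p, hp, e⟩ i
    exact ⟨p i, hp i, fun x => e x i⟩

lemma aux_cross (q : Fin 3 → MvPolynomial (Fin 3) ℝ) (y : Fin 3 → ℝ) (i : Fin 3) :
    MvPolynomial.eval y (crossProduct q MvPolynomial.X i) =
      crossProduct (fun i => MvPolynomial.eval y (q i)) y i := by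
  fin_cases i <;> simp [cross_apply]

lemma aux_cross_deg (q : Fin 3 → MvPolynomial (Fin 3) ℝ) (m : ℕ)
    (h : ∀ i, (q i).totalDegree ≤ m) (i : Fin 3) :
    (crossProduct q MvPolynomial.X i).totalDegree ≤ m + 1 := by
  have H : ∀ i j, (q i * MvPolynomial.X j).totalDegree ≤ m + 1 := fun i j =>
    (MvPolynomial.totalDegree_mul _ _).trans (by
      rw [MvPolynomial.totalDegree_X]; have := h i; omega)
  have K : ∀ i j k l, (q i * MvPolynomial.X j - q k * MvPolynomial.X l).totalDegree ≤ m + 1 :=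
    fun i j k l => (MvPolynomial.totalDegree_sub _ _).trans (max_le (H _ _) (H _ _))
  rw [cross_apply]
  fin_cases i
  · simpa [mul_comm] using K 1 2 2 1
  · simpa [mul_comm] using K 2 0 0 2
  · simpa [mul_comm] using K 0 1 1 0

lemma aux_const (P : MvPolynomial (Fin 3) ℝ)
    (h : ∀ y : Fin 3 → ℝ, ∑ i, y i * MvPolynomial.eval y (MvPolynomial.pderiv i P) = 0) 
    (y : Fin 3 → ℝ) : MvPolynomial.eval y P = MvPolynomial.eval 0 P := by
  have hd : ∀ t : ℝ, HasDerivAt (fun t : ℝ => MvPolynomial.eval (t • y) P)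
      (∑ i, y i * MvPolynomial.eval (t • y) (MvPolynomial.pderiv i P)) t := by
    intro t
    have h1 : HasDerivAt (fun t : ℝ => t • y) y t := by
      simpa using (hasDerivAt_id t).smul_const y
    have := (aux_hasFDeriv P (t • y)).comp_hasDerivAt t h1
    refine this.congr_deriv ?_
    simp [Fin.sum_univ_three, mul_comm]
  obtain ⟨t, ht, e⟩ := exists_hasDerivAt_eq_slope (fun t : ℝ => MvPolynomial.eval (t • y) P) _
    zero_lt_one (fun t _ => (hd t).continuousAt.continuousWithinAt) (fun t _ => hd t)
  have h2 := h (t • y)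
  simp only [Pi.smul_apply, smul_eq_mul, mul_assoc, ← Finset.mul_sum] at h2
  have h3 := (mul_eq_zero.1 h2).resolve_left ht.1.ne'
  rw [h3] at e
  simp only [one_smul, zero_smul, sub_zero, div_one] at e
  linarith

lemma aux_line (P : MvPolynomial (Fin 3) ℝ) (m : ℕ) (h : P.totalDegree ≤ m) :
    ∃ R : Polynomial ℝ, R.natDegree ≤ m ∧
      ∀ t : ℝ, MvPolynomial.eval ![t, 0, 0] P = R.eval t := by
  refine ⟨MvPolynomial.aeval ![Polynomial.X, 0, 0] P, ?_, ?_⟩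
  · have := MvPolynomial.aeval_natDegree_le (n := 1) P h ![(Polynomial.X : Polynomial ℝ), 0, 0]
      (by intro i; fin_cases i <;> simp)
    simpa using this
  · intro t
    rw [← Polynomial.coe_aeval_eq_eval, ← MvPolynomial.coe_aeval_eq_eval]
    change _ = ((Polynomial.aeval t).comp (MvPolynomial.aeval _)) P
    rw [MvPolynomial.comp_aeval]
    have : (fun i => (Polynomial.aeval t) ((![Polynomial.X, 0, 0] : Fin 3 → Polynomial ℝ) i))
        = ![t, 0, 0] := by
      funext i
      fin_cases i <;> simp
    rw [this]
    rfl

lemma aux_pow (R : Polynomial ℝ) (m : ℕ) (h : R.natDegree ≤ m)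
    (e : ∀ t : ℝ, R.eval t = t ^ (m + 1)) : False := by
  have : R = Polynomial.X ^ (m + 1) := Polynomial.funext fun t => by simp [e]
  rw [this] at h
  simp at h

lemma aux_dot (u y : Fin 3 → ℝ) : ∑ i, y i * crossProduct u y i = 0 := by
  simp [Fin.sum_univ_three, cross_apply]; ring

/-- The Nédélec space `𝒩ⁿ_c = 𝒢^{n-1} ⊕ 𝒢ⁿ_c` in `ℝ³`:
(i) the sum is direct, (ii) `𝒩ⁿ_c = (𝒫^{n-1})³ + 𝒢ⁿ_c`, and
(iii) `(𝒫^{n-1})³ ⊊ 𝒩ⁿ_c ⊊ (𝒫ⁿ)³`. -/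
theorem statement5 (n : ℕ) (hn : 1 ≤ n) (c : Fin 3 → ℝ) :
    let G : Set ((Fin 3 → ℝ) → (Fin 3 → ℝ)) :=
      {f | ∃ p ∈ polySpaceZ 3 (n : ℤ), f = grad p}
    let Gc : Set ((Fin 3 → ℝ) → (Fin 3 → ℝ)) :=
      {f | ∃ q ∈ vecPolySpaceZ 3 ((n : ℤ) - 1),
        f = fun x => crossProduct (q x) (x - c)}
    let N : Set ((Fin 3 → ℝ) → (Fin 3 → ℝ)) :=
      {f | ∃ g ∈ G, ∃ h ∈ Gc, f = g + h}
    (∀ g ∈ G, ∀ h ∈ Gc, ∀ g' ∈ G, ∀ h' ∈ Gc, g + h = g' + h' → g = g' ∧ h = h') ∧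
    N = {f | ∃ g ∈ vecPolySpaceZ 3 ((n : ℤ) - 1), ∃ h ∈ Gc, f = g + h} ∧
    (vecPolySpaceZ 3 ((n : ℤ) - 1) : Set _) ⊂ N ∧
    N ⊂ (vecPolySpaceZ 3 (n : ℤ) : Set _) := by
  obtain ⟨m, rfl⟩ : ∃ m, n = m + 1 := ⟨n - 1, by omega⟩
  have hm : (((m + 1 : ℕ) : ℤ) - 1) = (m : ℤ) := by push_cast; ring
  intro G Gc N
  have hG : ∀ g, g ∈ G ↔ ∃ p : MvPolynomial (Fin 3) ℝ, p.totalDegree ≤ m + 1 ∧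
      ∀ x i, g x i = MvPolynomial.eval (x - c) (MvPolynomial.pderiv i p) := by
    intro g
    constructor
    · rintro ⟨f, hf, rfl⟩
      obtain ⟨p, hp, e⟩ := (aux_mem' _ c _).1 hf
      exact ⟨p, hp, aux_grad p f c e⟩
    · rintro ⟨p, hp, e⟩
      refine ⟨fun x => MvPolynomial.eval (x - c) p, (aux_mem' _ c _).2 ⟨p, hp, fun _ => rfl⟩, ?_⟩
      funext x i
      rw [e, aux_grad p _ c (fun _ => rfl)]
  have hGc : ∀ h, h ∈ Gc ↔ ∃ q : Fin 3 → MvPolynomial (Fin 3) ℝ, (∀ i, (q i).totalDegree ≤ m) ∧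
      ∀ x i, h x i = MvPolynomial.eval (x - c) (crossProduct q MvPolynomial.X i) := by
    intro h
    constructor
    · rintro ⟨f, hf, rfl⟩
      rw [hm] at hf
      obtain ⟨q, hq, e⟩ := (aux_vmem _ c _).1 hf
      refine ⟨q, hq, fun x i => ?_⟩
      rw [aux_cross]
      simp only [← e]
    · rintro ⟨q, hq, e⟩
      refine ⟨fun x i => MvPolynomial.eval (x - c) (q i), ?_, ?_⟩
      · rw [hm]
        exact (aux_vmem _ c _).2 ⟨q, hq, fun _ _ => rfl⟩
      · funext x i
        rw [e, aux_cross]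
  have hGV : ∀ g ∈ G, g ∈ vecPolySpaceZ 3 (m : ℤ) := by
    intro g hg
    obtain ⟨p, hp, e⟩ := (hG g).1 hg
    exact (aux_vmem _ c _).2 ⟨_, fun i => aux_pderiv_deg p _ hp i, e⟩
  have hGcAdd : ∀ a ∈ Gc, ∀ b ∈ Gc, a + b ∈ Gc := by
    rintro a ⟨u, hu, rfl⟩ b ⟨v, hv, rfl⟩
    exact ⟨u + v, Submodule.add_mem _ hu hv, by funext x; simp⟩
  have hVN : ∀ g ∈ vecPolySpaceZ 3 (m : ℤ), g ∈ N := by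
    intro g hg
    obtain ⟨P, hP, e⟩ := (aux_vmem _ c _).1 hg
    obtain ⟨p, q, hp, hq, e'⟩ := aux_poinc m P hP
    refine ⟨fun x i => MvPolynomial.eval (x - c) (MvPolynomial.pderiv i p),
      (hG _).2 ⟨p, hp, fun _ _ => rfl⟩,
      fun x i => MvPolynomial.eval (x - c) (crossProduct q MvPolynomial.X i),
      (hGc _).2 ⟨q, hq, fun _ _ => rfl⟩, ?_⟩
    funext x i
    rw [e, e', map_add]
    rfl
  have hN : N = {f | ∃ g ∈ vecPolySpaceZ 3 (((m + 1 : ℕ) : ℤ) - 1), ∃ h ∈ Gc, f = g + h} := by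
    rw [hm]
    ext f
    constructor
    · rintro ⟨g, hg, h, hh, rfl⟩
      exact ⟨g, hGV g hg, h, hh, rfl⟩
    · rintro ⟨g, hg, h, hh, rfl⟩
      obtain ⟨g', hg', h', hh', rfl⟩ := hVN g hg
      exact ⟨g', hg', h' + h, hGcAdd _ hh' _ hh, add_assoc _ _ _⟩
  have hline : ∀ t : ℝ, (![t, 0, 0] + c) - c = ![t, 0, 0] := fun t => add_sub_cancel_right _ _
  refine ⟨?_, hN, ?_, ?_⟩
  · intro g hg h hh g' hg' h' hh' e
    suffices hs : g = g' by
      refine ⟨hs, ?_⟩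
      rw [hs] at e
      exact add_left_cancel e
    obtain ⟨p, hp, e1⟩ := (hG g).1 hg
    obtain ⟨p', hp', e1'⟩ := (hG g').1 hg'
    obtain ⟨q, hq, e2⟩ := (hGc h).1 hh
    obtain ⟨q', hq', e2'⟩ := (hGc h').1 hh'
    have key : ∀ y : Fin 3 → ℝ,
        ∑ i, y i * MvPolynomial.eval y (MvPolynomial.pderiv i (p - p')) = 0 := by
      intro y
      have h1 := aux_dot (fun i => MvPolynomial.eval y (q i)) y
      have h2 := aux_dot (fun i => MvPolynomial.eval y (q' i)) y
      simp only [← aux_cross] at h1 h2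
      have h3 : ∀ i, MvPolynomial.eval y (MvPolynomial.pderiv i (p - p')) =
          MvPolynomial.eval y (crossProduct q' MvPolynomial.X i) -
          MvPolynomial.eval y (crossProduct q MvPolynomial.X i) := by
        intro i
        have := congrFun (congrFun e (y + c)) i
        simp only [Pi.add_apply, e1, e1', e2, e2', add_sub_cancel_right] at this
        rw [map_sub, map_sub]
        linarith
      simp only [h3, mul_sub, Finset.sum_sub_distrib, h1, h2, sub_zero]
    have hc := aux_const _ key
    have hpp : p - p' = MvPolynomial.C (MvPolynomial.eval 0 (p - p')) :=
      MvPolynomial.funext fun y => by rw [hc y, MvPolynomial.eval_C]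
    funext x i
    have h5 : MvPolynomial.pderiv i (p - p') = 0 := by rw [hpp, MvPolynomial.pderiv_C]
    rw [map_sub, sub_eq_zero] at h5
    rw [e1, e1', h5]
  · rw [hm]
    refine ⟨hVN, fun hsub => ?_⟩
    let q : Fin 3 → MvPolynomial (Fin 3) ℝ := ![0, -MvPolynomial.X 0 ^ m, 0]
    have hq : ∀ i, (q i).totalDegree ≤ m := by
      intro i; fin_cases i <;> simp [q]
    have hmem : (fun x i => MvPolynomial.eval (x - c) (crossProduct q MvPolynomial.X i)) ∈ N := by
      rw [hN]
      exact ⟨0, Submodule.zero_mem _, _, (hGc _).2 ⟨q, hq, fun _ _ => rfl⟩, (zero_add _).symm⟩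
    obtain ⟨P, hP, e⟩ := (aux_vmem _ c _).1 (hsub hmem)
    obtain ⟨R, hR, e'⟩ := aux_line (P 2) m (hP 2)
    refine aux_pow R m hR fun t => ?_
    have := e (![t, 0, 0] + c) 2
    rw [hline, e'] at this
    rw [← this]
    simp [cross_apply, q, pow_succ]
  · refine ⟨?_, fun hsub => ?_⟩
    · intro f hf
      rw [hN, hm] at hf
      obtain ⟨g, hg, h, hh, rfl⟩ := hf
      obtain ⟨P, hP, e⟩ := (aux_vmem _ c _).1 hg
      obtain ⟨q, hq, e'⟩ := (hGc h).1 hh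
      refine Submodule.add_mem _ ?_ ?_
      · exact (aux_vmem _ c _).2 ⟨P, fun i => (hP i).trans (Nat.le_succ _), e⟩
      · exact (aux_vmem _ c _).2 ⟨_, aux_cross_deg q m hq, e'⟩
    · let P : Fin 3 → MvPolynomial (Fin 3) ℝ := ![MvPolynomial.X 0 ^ (m + 1), 0, 0]
      have hP : ∀ i, (P i).totalDegree ≤ m + 1 := by
        intro i; fin_cases i <;> simp [P]
      have hmem : (fun x i => MvPolynomial.eval (x - c) (P i)) ∈ N :=
        hsub ((aux_vmem _ c _).2 ⟨P, hP, fun _ _ => rfl⟩)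
      rw [hN, hm] at hmem
      obtain ⟨g, hg, h, hh, e⟩ := hmem
      obtain ⟨Q, hQ, e1⟩ := (aux_vmem _ c _).1 hg
      obtain ⟨q, hq, e2⟩ := (hGc h).1 hh
      obtain ⟨R, hR, e'⟩ := aux_line (Q 0) m (hQ 0)
      refine aux_pow R m hR fun t => ?_
      have := congrFun (congrFun e (![t, 0, 0] + c)) 0
      simp only [Pi.add_apply, e1, e2, hline, e'] at this
      simpa [cross_apply, P] using this.symm

end
end
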